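/- arXiv:0807.1403 — 3 statements merged into one kernel-verified Lean document; each statement's English description precedes it below -/
import Mathlib

section
/- Let K be a field and let R be a regular local ring which is a K-algebra such that the composite K → R → R/m (m the maximal ideal of R) is an isomorphism of fields, and let L be the fraction field of R. Let D be a finite-dimensional division algebra over K with center K. Then L ⊗_K D is a division ring, so the index of L ⊗_K D equals the index of D. -/
open scoped TensorProduct

namespace IsLocalRing

variable {R : Type*} [CommRing R] [IsLocalRing R]

theorem exists_finset_span_eq_maximalIdeal_quotient {x : R} (hx : x ∈ maximalIdeal R)
    (hx2 : x ∉ maximalIdeal R ^ 2) {s : Finset R}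
    (hs : Ideal.span (s : Set R) = maximalIdeal R) [IsLocalRing (R ⧸ Ideal.span {x})] :
    ∃ t : Finset (R ⧸ Ideal.span {x}), t.card < s.card ∧
      Ideal.span (t : Set (R ⧸ Ideal.span {x})) = maximalIdeal (R ⧸ Ideal.span {x}) := by
  classical
  obtain ⟨f, -, hf⟩ := Submodule.mem_span_finset.mp (hs ▸ hx : x ∈ Ideal.span (s : Set R))
  obtain ⟨y, hy, hfy⟩ : ∃ y ∈ s, IsUnit (f y) := by
    by_contra! hcon
    refine hx2 (hf ▸ Ideal.sum_mem _ fun y hy ↦ ?_)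
    rw [pow_two]
    exact Ideal.mul_mem_mul ((mem_maximalIdeal _).mpr (hcon y hy))
      (hs ▸ Ideal.subset_span hy)
  let π := Ideal.Quotient.mk (Ideal.span {x})
  refine ⟨(s.erase y).image π,
    Finset.card_image_le.trans_lt (Finset.card_erase_lt_of_mem hy), ?_⟩
  have hmap : (maximalIdeal R).map π = maximalIdeal (R ⧸ Ideal.span {x}) := by
    have := Ideal.map_eq_top_or_isMaximal_of_surjective π Ideal.Quotient.mk_surjective
      (maximalIdeal.isMaximal R)
    refine (eq_maximalIdeal (this.resolve_left fun htop ↦ ?_))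
    have h1 := congrArg (Ideal.comap π) htop
    rw [Ideal.comap_map_of_surjective _ Ideal.Quotient.mk_surjective, Ideal.comap_top,
      ← RingHom.ker_eq_comap_bot, Ideal.mk_ker, sup_eq_left.mpr] at h1
    · exact (maximalIdeal.isMaximal R).ne_top h1
    · simpa [Ideal.span_le] using hx
  rw [← hmap, ← hs, Ideal.map_span]
  refine le_antisymm (Ideal.span_mono ?_) (Ideal.span_le.mpr ?_)
  · rw [Finset.coe_image]
    exact Set.image_mono (by simp)
  · rintro _ ⟨z, hz, rfl⟩
    have hmem : ∀ w ∈ s.erase y,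
        π w ∈ Ideal.span (((s.erase y).image π : Finset _) : Set (R ⧸ Ideal.span {x})) :=
      fun w hw ↦ Ideal.subset_span (by simpa using ⟨w, by simpa [and_comm] using hw, rfl⟩)
    by_cases hzy : z = y
    · subst hzy
      have h0 : π (f z) * π z + ∑ w ∈ s.erase z, π (f w) * π w = 0 := by
        rw [Finset.add_sum_erase s (fun w ↦ π (f w) * π w) hy]
        have := congrArg π hf
        simp only [smul_eq_mul, map_sum, map_mul] at this
        rw [this]
        exact Ideal.Quotient.eq_zero_iff_mem.mpr (Ideal.mem_span_singleton_self x)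
      refine (Ideal.unit_mul_mem_iff_mem _ (hfy.map π)).mp ?_
      rw [eq_neg_of_add_eq_zero_left h0]
      exact neg_mem (Ideal.sum_mem _ fun w hw ↦ Ideal.mul_mem_left _ _ (hmem w hw))
    · exact hmem z (Finset.mem_erase.mpr ⟨hzy, hz⟩)

variable [IsNoetherianRing R]

theorem exists_mem_maximalIdeal_notMem_sq_notMem_minimalPrimes (h : 0 < ringKrullDim R) :
    ∃ x ∈ maximalIdeal R, x ∉ maximalIdeal R ^ 2 ∧ ∀ p ∈ minimalPrimes R, x ∉ p := by
  classical
  have hmin : maximalIdeal R ∉ minimalPrimes R := by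
    intro hm
    have : Ring.KrullDimLE 0 R := by
      refine Ring.krullDimLE_zero_iff.mpr fun I hI ↦ ?_
      have hle := le_maximalIdeal hI.ne_top
      have : I = maximalIdeal R := le_antisymm hle (hm.2 ⟨hI, bot_le⟩ hle)
      exact this ▸ maximalIdeal.isMaximal R
    exact absurd h (not_lt.mpr ((Ring.krullDimLE_iff).mp this))
  by_contra! hcon
  have hfin := minimalPrimes.finite_of_isNoetherianRing R
  have hsub : (maximalIdeal R : Set R) ⊆
      ⋃ I ∈ ((insert (maximalIdeal R ^ 2) hfin.toFinset : Finset (Ideal R)) : Set (Ideal R)),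
        (I : Set R) := by
    intro x hx
    by_cases hx2 : x ∈ maximalIdeal R ^ 2
    · exact Set.mem_biUnion (by simp) hx2
    · obtain ⟨p, hp, hxp⟩ := hcon x hx hx2
      exact Set.mem_biUnion (by simp [hp]) hxp
  obtain ⟨I, hI, hle⟩ := (Ideal.subset_union_prime (f := id) (maximalIdeal R ^ 2)
    (maximalIdeal R ^ 2) (fun I hI h2 _ ↦ by
      simp only [Finset.mem_insert, h2, Set.Finite.mem_toFinset, false_or] at hI
      exact hI.1.1)).mp hsub
  simp only [Finset.mem_insert, Set.Finite.mem_toFinset, id] at hI hle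
  obtain rfl | hI := hI
  · have hbot : maximalIdeal R = ⊥ :=
      Submodule.eq_bot_of_le_smul_of_le_jacobson_bot (maximalIdeal R) _
        (IsNoetherian.noetherian _) (by simpa [pow_two] using hle)
        (maximalIdeal_le_jacobson _)
    exact hmin ⟨⟨inferInstance, bot_le⟩, fun q _ _ ↦ hbot ▸ bot_le⟩
  · have := hI.1.1
    exact hmin (le_antisymm hle (le_maximalIdeal this.ne_top) ▸ hI)

theorem isDomain_of_isPrime_span_singleton {x : R} (hx : x ∈ maximalIdeal R)
    (hp : (Ideal.span {x}).IsPrime) (hmin : ∀ p ∈ minimalPrimes R, x ∉ p) : IsDomain R := by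
  obtain ⟨p, hpm, hle⟩ := Ideal.exists_minimalPrimes_le (bot_le : ⊥ ≤ Ideal.span {x})
  have hprime : p.IsPrime := hpm.1.1
  have hbot : p = ⊥ := by
    refine Submodule.eq_bot_of_le_smul_of_le_jacobson_bot (Ideal.span {x}) p
      (IsNoetherian.noetherian _) (fun y hy ↦ ?_) ?_
    · obtain ⟨z, rfl⟩ := Ideal.mem_span_singleton.mp (hle hy)
      exact Ideal.mul_mem_mul (Ideal.mem_span_singleton_self x)
        ((hprime.mem_or_mem hy).resolve_left (hmin p hpm))
    · refine le_trans ?_ (maximalIdeal_le_jacobson _)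
      simpa [Ideal.span_le] using hx
  exact IsDomain.of_bot_isPrime R (hbp := hbot ▸ hprime)

end IsLocalRing

section TensorProduct

variable {K : Type*} [Field K] {D : Type*} [Ring D] [Algebra K D]

theorem Algebra.TensorProduct.exists_smul_eq_of_map_mk_eq_zero {R : Type*} [CommRing R]
    [Algebra K R] (x : R) {a : R ⊗[K] D}
    (ha : Algebra.TensorProduct.map (Ideal.Quotient.mkₐ K (Ideal.span {x})) (AlgHom.id K D) a = 0) :
    ∃ a', a = x • a' := by
  have hex := rTensor_exact D
    (f := ((LinearMap.mulLeft R x).restrictScalars K))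
    (g := (Ideal.Quotient.mkₐ K (Ideal.span {x})).toLinearMap)
    (fun y ↦ by
      simp [Ideal.Quotient.eq_zero_iff_mem, Ideal.mem_span_singleton, dvd_def,
        eq_comm (a := y)])
    Ideal.Quotient.mk_surjective
  obtain ⟨a', rfl⟩ := (hex a).mp ha
  refine ⟨a', ?_⟩
  clear ha
  induction a' with
  | zero => simp
  | tmul r d => simp [TensorProduct.smul_tmul']
  | add a b ha hb => rw [map_add, ha, hb, smul_add]

/-- If `x` is a nonzero element of the maximal ideal of a Noetherian local domain `R` and
`R ⧸ (x) ⊗ D` has no zero divisors, then neither does `R ⊗ D`. -/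
theorem Algebra.TensorProduct.noZeroDivisors_of_quotient_span_singleton {R : Type*} [CommRing R]
    [IsNoetherianRing R] [IsLocalRing R] [IsDomain R] [Algebra K R] {x : R}
    (hx : x ∈ IsLocalRing.maximalIdeal R) (hx0 : x ≠ 0)
    [NoZeroDivisors ((R ⧸ Ideal.span {x}) ⊗[K] D)] : NoZeroDivisors (R ⊗[K] D) := by
  let φ := Algebra.TensorProduct.map (Ideal.Quotient.mkₐ K (Ideal.span {x})) (AlgHom.id K D)
  let b := Algebra.TensorProduct.basis R (Module.Basis.ofVectorSpace K D)
  have hfree : Module.Free R (R ⊗[K] D) := .of_basis b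
  have key (a : R ⊗[K] D) (ha : a ≠ 0) : ∃ (n : ℕ) (a' : R ⊗[K] D), a = x ^ n • a' ∧ φ a' ≠ 0 := by
    by_contra! hcon
    have hall (n : ℕ) : ∃ a', a = x ^ n • a' := by
      induction n with
      | zero => exact ⟨a, by simp⟩
      | succ n ih =>
        obtain ⟨a', h⟩ := ih
        obtain ⟨a'', rfl⟩ := exists_smul_eq_of_map_mk_eq_zero x (hcon n a' h)
        exact ⟨a'', by rw [h, smul_smul, pow_succ]⟩
    refine ha (b.ext_elem fun i ↦ ?_)
    rw [map_zero, Finsupp.zero_apply, ← Ideal.mem_bot,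
      ← Ideal.iInf_pow_eq_bot_of_isLocalRing (IsLocalRing.maximalIdeal R)
        (IsLocalRing.maximalIdeal.isMaximal R).ne_top, Ideal.mem_iInf]
    intro n
    obtain ⟨a', h⟩ := hall n
    rw [h, map_smul, Finsupp.smul_apply, smul_eq_mul]
    exact Ideal.mul_mem_right _ _ (Ideal.pow_mem_pow hx n)
  refine ⟨fun {a c} hac ↦ ?_⟩
  by_contra! hne
  obtain ⟨n, a', rfl, ha'⟩ := key a hne.1
  obtain ⟨m, c', rfl, hc'⟩ := key c hne.2
  rw [smul_mul_smul_comm, smul_eq_zero_iff_right (mul_ne_zero (pow_ne_zero _ hx0)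
    (pow_ne_zero _ hx0))] at hac
  exact mul_ne_zero ha' hc' (by rw [← map_mul, hac, map_zero])

theorem Algebra.TensorProduct.noZeroDivisors_of_surjective_algebraMap [IsDomain D] {R : Type*}
    [CommRing R] [Nontrivial R] [Algebra K R] (h : Function.Surjective (algebraMap K R)) :
    NoZeroDivisors (R ⊗[K] D) :=
  ((Algebra.TensorProduct.congr
    (AlgEquiv.ofBijective (Algebra.ofId K R) ⟨(algebraMap K R).injective, h⟩)
    AlgEquiv.refl).symm.trans (Algebra.TensorProduct.lid K D)).toMulEquiv.noZeroDivisors D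

/-- The tensor product of a domain with a regular local ring having residue field `K` has no
zero divisors. -/
theorem Algebra.TensorProduct.noZeroDivisors_of_regularLocal [IsDomain D] (n : ℕ) :
    ∀ (R : Type*) [CommRing R] [IsNoetherianRing R] [IsLocalRing R] [Algebra K R],
    Function.Surjective ((IsLocalRing.residue R).comp (algebraMap K R)) →
    ∀ s : Finset R, Ideal.span (s : Set R) = IsLocalRing.maximalIdeal R → s.card ≤ n →
    (n : WithBot ℕ∞) ≤ ringKrullDim R → NoZeroDivisors (R ⊗[K] D) := by
  induction n with
  | zero =>
    intro R _ _ _ _ hres s hs hcard _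
    obtain rfl : s = ∅ := by simpa using hcard
    refine noZeroDivisors_of_surjective_algebraMap fun r ↦ ?_
    obtain ⟨k, hk⟩ := hres (IsLocalRing.residue R r)
    refine ⟨k, sub_eq_zero.mp ?_⟩
    have : algebraMap K R k - r ∈ IsLocalRing.maximalIdeal R := by
      rw [← IsLocalRing.residue_eq_zero_iff, map_sub, ← hk, RingHom.comp_apply, sub_self]
    simpa [← hs] using this
  | succ n ih =>
    intro R _ _ _ _ hres s hs hcard hdim
    obtain ⟨x, hx, hx2, hmin⟩ :=
      IsLocalRing.exists_mem_maximalIdeal_notMem_sq_notMem_minimalPrimes (R := R)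
        ((Nat.cast_nonneg' n).trans_lt
          (ENat.WithBot.add_one_le_iff.mp (by simpa using hdim)))
    have hne : Ideal.span {x} ≠ ⊤ := fun h ↦ (IsLocalRing.mem_maximalIdeal x).mp hx
      (Ideal.span_singleton_eq_top.mp h)
    have : Nontrivial (R ⧸ Ideal.span {x}) := Ideal.Quotient.nontrivial_iff.mpr hne
    have : IsLocalRing (R ⧸ Ideal.span {x}) :=
      .of_surjective' _ Ideal.Quotient.mk_surjective
    obtain ⟨t, ht, hspan⟩ := IsLocalRing.exists_finset_span_eq_maximalIdeal_quotient hx hx2 hs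
    have hnzd : NoZeroDivisors ((R ⧸ Ideal.span {x}) ⊗[K] D) := by
      refine ih (R ⧸ Ideal.span {x}) ?_ t hspan (by omega) ?_
      · intro y
        obtain ⟨y, rfl⟩ := IsLocalRing.residue_surjective y
        obtain ⟨r, rfl⟩ := Ideal.Quotient.mk_surjective y
        obtain ⟨k, hk⟩ := hres (IsLocalRing.residue R r)
        refine ⟨k, ?_⟩
        rw [RingHom.comp_apply, ← sub_eq_zero, ← map_sub, IsLocalRing.residue_eq_zero_iff] at hk ⊢
        rw [IsScalarTower.algebraMap_apply K R (R ⧸ Ideal.span {x}), Ideal.Quotient.algebraMap_eq,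
          ← map_sub]
        rw [IsLocalRing.mem_maximalIdeal, mem_nonunits_iff] at hk ⊢
        have := IsLocalHom.of_surjective (Ideal.Quotient.mk (Ideal.span {x}))
          Ideal.Quotient.mk_surjective
        exact fun h ↦ hk (isUnit_of_map_unit _ _ h)
      · have h := ringKrullDim_le_ringKrullDim_quotient_add_encard ({x} : Set R)
          (by simpa [IsLocalRing.ringJacobson_eq_maximalIdeal] using hx)
        exact ENat.WithBot.add_le_add_one_right_iff.mp (by simpa using hdim.trans h)
    have hinj : Function.Injective
        (Algebra.TensorProduct.includeLeft : R ⧸ Ideal.span {x} →ₐ[K] _ ⊗[K] D) :=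
      Algebra.TensorProduct.includeLeft_injective (algebraMap K D).injective
    have hnzd' := hinj.noZeroDivisors _ (map_zero _) (map_mul _)
    have hprime : (Ideal.span {x}).IsPrime :=
      (Ideal.Quotient.isDomain_iff_prime _).mp (NoZeroDivisors.to_isDomain _)
    have := IsLocalRing.isDomain_of_isPrime_span_singleton hx hprime hmin
    exact noZeroDivisors_of_quotient_span_singleton hx (fun h ↦ hx2 (h ▸ zero_mem _))

theorem Algebra.TensorProduct.noZeroDivisors_of_isFractionRing {R L : Type*} [CommRing R]
    [Algebra K R] [Field L] [Algebra R L] [IsFractionRing R L] [Algebra K L] [IsScalarTower K R L]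
    [NoZeroDivisors (R ⊗[K] D)] : NoZeroDivisors (L ⊗[K] D) := by
  let ψ := Algebra.TensorProduct.map (IsScalarTower.toAlgHom K R L) (AlgHom.id K D)
  have hψ : Function.Injective ψ :=
    Module.Flat.rTensor_preserves_injective_linearMap (M := D)
      (IsScalarTower.toAlgHom K R L).toLinearMap (IsFractionRing.injective R L)
  have hsmul (r : R) (a : R ⊗[K] D) : ψ (r • a) = algebraMap R L r • ψ a := by
    induction a with
    | zero => simp
    | tmul c d => simp [ψ, Algebra.smul_def]
    | add a b ha hb => rw [smul_add, map_add, ha, hb, map_add, smul_add]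
  have key (y : L ⊗[K] D) : ∃ l : L, l ≠ 0 ∧ ∃ a, l • y = ψ a := by
    have hR (r : nonZeroDivisors R) : algebraMap R L r ≠ 0 :=
      (IsLocalization.map_units L r).ne_zero
    suffices ∃ r : nonZeroDivisors R, ∃ a, algebraMap R L r • y = ψ a from
      let ⟨r, h⟩ := this
      ⟨_, hR r, h⟩
    induction y with
    | zero => exact ⟨1, 0, by simp⟩
    | tmul l d =>
      obtain ⟨⟨c, r⟩, h⟩ := IsLocalization.surj (nonZeroDivisors R) l
      exact ⟨r, c ⊗ₜ d, by simp [ψ, ← h, Algebra.smul_def, mul_comm]⟩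
    | add y z hy hz =>
      obtain ⟨r, a, ha⟩ := hy
      obtain ⟨s, c, hc⟩ := hz
      refine ⟨r * s, (s : R) • a + (r : R) • c, ?_⟩
      rw [map_add, hsmul, hsmul, ← ha, ← hc, smul_smul, smul_smul, smul_add, Submonoid.coe_mul,
        map_mul, mul_comm (algebraMap R L s)]
  refine ⟨fun {y z} hyz ↦ ?_⟩
  obtain ⟨l, hl, a, ha⟩ := key y
  obtain ⟨k, hk, c, hc⟩ := key z
  have hac : a * c = 0 := hψ (by
    rw [map_mul, ← ha, ← hc, smul_mul_smul_comm, hyz, smul_zero, map_zero])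
  obtain rfl | rfl := mul_eq_zero.mp hac
  · exact .inl ((smul_eq_zero_iff_right hl).mp (by rw [ha, map_zero]))
  · exact .inr ((smul_eq_zero_iff_right hk).mp (by rw [hc, map_zero]))

end TensorProduct

/-- Let `K` be a field and `R` a regular local ring (a Noetherian local ring whose maximal
ideal is generated by `dim R` elements) containing `K` whose residue field is `K` (i.e. the
composite `K → R → R/m` is an isomorphism), with fraction field `L`.  If `D` is a
finite-dimensional central division algebra over `K`, then `L ⊗_K D` is a division ring, so
the index of `L ⊗_K D` equals the index of `D`. -/
theorem tensor_fractionField_of_regularLocal_isDivisionRing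
    (K R L : Type*) [Field K] [CommRing R] [IsNoetherianRing R] [IsLocalRing R]
    (hreg : ∃ s : Finset R, Ideal.span (s : Set R) = IsLocalRing.maximalIdeal R ∧
      (s.card : WithBot (WithTop ℕ)) = ringKrullDim R)
    [Algebra K R]
    (hres : Function.Bijective ((IsLocalRing.residue R).comp (algebraMap K R)))
    [Field L] [Algebra R L] [IsFractionRing R L] [Algebra K L] [IsScalarTower K R L]
    (D : Type*) [DivisionRing D] [Algebra K D] [Algebra.IsCentral K D]
    [FiniteDimensional K D] :
    (∀ x : L ⊗[K] D, x ≠ 0 → IsUnit x) ∧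
      Module.finrank L (L ⊗[K] D) = Module.finrank K D := by
  obtain ⟨s, hs, hdim⟩ := hreg
  have : NoZeroDivisors (R ⊗[K] D) :=
    Algebra.TensorProduct.noZeroDivisors_of_regularLocal s.card R hres.2 s hs le_rfl hdim.le
  have : NoZeroDivisors (L ⊗[K] D) :=
    Algebra.TensorProduct.noZeroDivisors_of_isFractionRing (R := R)
  have : IsDomain (L ⊗[K] D) := NoZeroDivisors.to_isDomain _
  exact ⟨fun x hx ↦ FiniteDimensional.isUnit L hx, Module.finrank_baseChange⟩
end

section
/- Let k be a field, let R = k[[x,y]] be the ring of formal power series in two variables over k, and let m = (x,y) be its maximal ideal. Let f ∈ R be such that f − xy ∈ m^3. Then there exist p, q ∈ m^2 such that f = (x + p)(y + q). In particular, after the change of coordinates x' = x + p, y' = y + q (which generate m), one has f = x'y'. -/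
theorem Ideal.exists_of_mem_mul_span_pair {R : Type*} [CommRing R] {I : Ideal R} {x y z : R}
    (hz : z ∈ I * Ideal.span {x, y}) : ∃ a ∈ I, ∃ b ∈ I, z = a * x + b * y := by
  rw [Ideal.span_insert, Ideal.mul_sup] at hz
  obtain ⟨u, hu, v, hv, rfl⟩ := Submodule.mem_sup.1 hz
  obtain ⟨a, ha, rfl⟩ := Ideal.mem_mul_span_singleton.1 hu
  obtain ⟨b, hb, rfl⟩ := Ideal.mem_mul_span_singleton.1 hv
  exact ⟨a, ha, b, hb, rfl⟩

/-- Over a ring Henselian at `I`, a monic quadratic congruent to `T * (T - 1)` modulo `I` has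
a unit root congruent to `1`. -/
theorem HenselianRing.exists_isUnit_root_quadratic {R : Type*} [CommRing R] {I : Ideal R}
    [HenselianRing R I] {b c : R} (hb : b ∈ I) (hc : c ∈ I) :
    ∃ u : R, IsUnit u ∧ u - 1 ∈ I ∧ u ^ 2 - (1 + b) * u + c = 0 := by
  let P : Polynomial R :=
    Polynomial.X ^ 2 - Polynomial.C (1 + b) * Polynomial.X + Polynomial.C c
  have hmonic : P.Monic := by
    unfold P
    monicity!
  have heval : P.eval 1 ∈ I := by
    have : P.eval 1 = c - b := by simp [P]; ring
    exact this ▸ I.sub_mem hc hb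
  have hderiv : IsUnit (Ideal.Quotient.mk I (P.derivative.eval 1)) := by
    have : P.derivative.eval 1 = 1 - b := by simp [P]
    simp [this, Ideal.Quotient.eq_zero_iff_mem.2 hb]
  obtain ⟨u, hroot, hu⟩ := HenselianRing.is_henselian P hmonic 1 heval hderiv
  refine ⟨u, ?_, hu, by simpa [P, Polynomial.IsRoot.def] using hroot⟩
  simpa using Ideal.mem_jacobson_bot.1 (HenselianRing.jac hu) 1

/-- If `R` is Henselian at `(x, y)`, then every `f` congruent to `x * y` modulo `(x, y) ^ 3`
factors as a product of perturbations of `x` and `y` by elements of `(x, y) ^ 2`. -/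
theorem HenselianRing.exists_factor_of_sub_mul_mem_cube {R : Type*} [CommRing R] {x y f : R}
    [HenselianRing R (Ideal.span {x, y})] (hf : f - x * y ∈ Ideal.span {x, y} ^ 3) :
    ∃ p ∈ Ideal.span {x, y} ^ 2, ∃ q ∈ Ideal.span {x, y} ^ 2, f = (x + p) * (y + q) := by
  have hx : x ∈ Ideal.span {x, y} := Ideal.subset_span (by simp)
  have hy : y ∈ Ideal.span {x, y} := Ideal.subset_span (by simp)
  rw [pow_succ] at hf
  obtain ⟨g, hg, h, hh, hgh⟩ := Ideal.exists_of_mem_mul_span_pair hf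
  rw [pow_two] at hg hh ⊢
  obtain ⟨a, ha, b, hb, rfl⟩ := Ideal.exists_of_mem_mul_span_pair hg
  obtain ⟨b', hb', c, hc, rfl⟩ := Ideal.exists_of_mem_mul_span_pair hh
  obtain ⟨u, ⟨u, rfl⟩, hu, hroot⟩ := HenselianRing.exists_isUnit_root_quadratic
    (Ideal.add_mem _ hb hb') (Ideal.mul_mem_left _ a hc)
  refine ⟨↑u⁻¹ * c * y, Ideal.mul_mem_mul (Ideal.mul_mem_left _ _ hc) hy,
    a * x + (u - 1) * y, add_mem (Ideal.mul_mem_mul ha hx) (Ideal.mul_mem_mul hu hy), ?_⟩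
  have hinv : (u : R) * ↑u⁻¹ = 1 := u.mul_inv
  linear_combination hgh - x * y * ↑u⁻¹ * hroot +
    (x * y * (u - (1 + (b + b'))) - c * y ^ 2) * hinv


/-- Let `R = k[[x,y]]` with maximal ideal `m = (x, y)`.  If `f ∈ R` satisfies
`f - x * y ∈ m ^ 3`, then there exist `p, q ∈ m ^ 2` such that `f = (x + p) * (y + q)`;
in particular, after the change of coordinates `x' = x + p`, `y' = y + q` one has
`f = x' * y'`. -/
theorem mvPowerSeries_factor_of_sub_mul_mem_cube
    (k : Type*) [Field k] (f : MvPowerSeries (Fin 2) k)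
    (m : Ideal (MvPowerSeries (Fin 2) k))
    (hm : m = Ideal.span {MvPowerSeries.X 0, MvPowerSeries.X 1})
    (hf : f - MvPowerSeries.X 0 * MvPowerSeries.X 1 ∈ m ^ 3) :
    ∃ p q : MvPowerSeries (Fin 2) k, p ∈ m ^ 2 ∧ q ∈ m ^ 2 ∧
      f = (MvPowerSeries.X 0 + p) * (MvPowerSeries.X 1 + q) := by
  have hrange : Set.range (MvPowerSeries.X : Fin 2 → MvPowerSeries (Fin 2) k) =
      {MvPowerSeries.X 0, MvPowerSeries.X 1} := by
    ext; simp [Fin.exists_fin_two, eq_comm]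
  have hcomplete : IsAdicComplete
      (Ideal.span {MvPowerSeries.X 0, MvPowerSeries.X 1} : Ideal (MvPowerSeries (Fin 2) k))
      (MvPowerSeries (Fin 2) k) := hrange ▸ inferInstance
  subst hm
  obtain ⟨p, hp, q, hq, h⟩ := HenselianRing.exists_factor_of_sub_mul_mem_cube hf
  exact ⟨p, q, hp, hq, h⟩
end

section
/- Let R be an integral domain with fraction field F, and let I ⊆ R be an invertible ideal of R, with inverse fractional ideal I⁻¹ ⊆ F (so that I · I⁻¹ = R). Fix integers n ≥ 1 and 0 ≤ r ≤ n, and let A' be the set of n × n matrices a over F such that a_{ij} ∈ R whenever i, j ≤ r or i, j > r, a_{ij} ∈ I whenever i ≤ r < j, and a_{ij} ∈ I⁻¹ whenever j ≤ r < i. Then A' is an R-subalgebra of the matrix algebra M_n(F), and A' is an Azumaya algebra over R; in particular A' is finitely generated, faithful and projective as an R-module and the natural map A' ⊗_R (A')^op → End_R(A') is an isomorphism. -/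
open scoped TensorProduct

/-- The natural `R`-linear map `A ⊗[R] Aᵐᵒᵖ →ₗ[R] End_R A` sending `a ⊗ b` to the
endomorphism `x ↦ a * x * b`. -/
noncomputable def mulLeftRightMap (R A : Type*) [CommRing R] [Ring A] [Algebra R A] :
    A ⊗[R] Aᵐᵒᵖ →ₗ[R] Module.End R A :=
  TensorProduct.lift <|
    LinearMap.mk₂ R (fun a b => (LinearMap.mulLeft R a) ∘ₗ (LinearMap.mulRight R b.unop))
      (fun a₁ a₂ b => by ext x; simp [mul_add, add_mul])
      (fun r a b => by ext x; simp [Algebra.smul_mul_assoc])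
      (fun a b₁ b₂ => by ext x; simp [mul_add])
      (fun r a b => by ext x; simp [Algebra.mul_smul_comm, Algebra.smul_mul_assoc])

/-- The natural linear map `mulLeftRightMap` is the linear map underlying
`AlgHom.mulLeftRight`. -/
theorem mulLeftRightMap_eq_mulLeftRight (R A : Type*) [CommRing R] [Ring A] [Algebra R A] :
    mulLeftRightMap R A = (AlgHom.mulLeftRight R A).toLinearMap := by
  refine TensorProduct.ext' fun a b => LinearMap.ext fun x => ?_
  simp [mulLeftRightMap, mul_assoc]

section DualBasis

variable {R A S : Type*} [CommRing R] [Ring A] [Algebra R A] [Fintype S]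

theorem Module.Finite.of_dualBasis {w : S → A} {φ : S → A →ₗ[R] R}
    (h : ∀ x, ∑ s, φ s x • w s = x) : Module.Finite R A :=
  .of_surjective (Fintype.linearCombination R w) fun x => ⟨fun s => φ s x, h x⟩

theorem Module.Projective.of_dualBasis {w : S → A} {φ : S → A →ₗ[R] R}
    (h : ∀ x, ∑ s, φ s x • w s = x) : Module.Projective R A :=
  .of_split (LinearMap.pi φ) (Fintype.linearCombination R w) (LinearMap.ext h)

/-- If the functionals of a dual basis of `A` are realised as two-sided multiplications by
elements `t s` of `A ⊗ Aᵐᵒᵖ` which satisfy the identity `htw`, then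
`f ↦ ∑ s, (f (w s) ⊗ 1) * t s` is inverse to `AlgHom.mulLeftRight`. -/
theorem AlgHom.mulLeftRight_bijective_of_dualBasis {w : S → A} {φ : S → A →ₗ[R] R}
    {t : S → A ⊗[R] Aᵐᵒᵖ} (h : ∀ x, ∑ s, φ s x • w s = x)
    (ht : ∀ s x, AlgHom.mulLeftRight R A (t s) x = algebraMap R A (φ s x))
    (htw : ∀ b, ∑ s, ((w s * b) ⊗ₜ[R] (1 : Aᵐᵒᵖ)) * t s = 1 ⊗ₜ[R] MulOpposite.op b) :
    Function.Bijective (AlgHom.mulLeftRight R A) := by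
  let g : Module.End R A →ₗ[R] A ⊗[R] Aᵐᵒᵖ :=
    ∑ s, (LinearMap.mulRight R (t s)) ∘ₗ ((TensorProduct.mk R A Aᵐᵒᵖ).flip 1) ∘ₗ
      LinearMap.applyₗ (w s)
  have hg (f : Module.End R A) : g f = ∑ s, (f (w s) ⊗ₜ[R] (1 : Aᵐᵒᵖ)) * t s := by
    simp [g]
  refine Function.bijective_iff_has_inverse.mpr ⟨g, fun z => ?_, fun f => ?_⟩
  · have key : g ∘ₗ (AlgHom.mulLeftRight R A).toLinearMap = .id := by
      refine TensorProduct.ext' fun a b => ?_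
      have := congrArg ((a ⊗ₜ[R] (1 : Aᵐᵒᵖ)) * ·) (htw b.unop)
      simpa [hg, Finset.mul_sum, ← mul_assoc] using this
    exact LinearMap.congr_fun key z
  · ext x
    simp only [hg, map_sum, map_mul, LinearMap.sum_apply, Module.End.mul_apply, ht,
      AlgHom.mulLeftRight_apply, MulOpposite.unop_one, mul_one]
    conv_rhs => rw [← h x, map_sum]
    simp [Algebra.algebraMap_eq_smul_one]

end DualBasis

theorem Submodule.exists_fin_sum_mul_of_mem_mul {R A : Type*} [CommSemiring R] [Semiring A]
    [Algebra R A] {M N : Submodule R A} {x : A} (hx : x ∈ M * N) :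
    ∃ (m : ℕ) (u v : Fin m → A), (∀ a, u a ∈ M) ∧ (∀ a, v a ∈ N) ∧ ∑ a, u a * v a = x := by
  refine Submodule.mul_induction_on hx (fun y hy z hz => ?_) fun y z hy hz => ?_
  · exact ⟨1, fun _ => y, fun _ => z, by simp [hy, hz]⟩
  · obtain ⟨m, u, v, hu, hv, rfl⟩ := hy
    obtain ⟨m', u', v', hu', hv', rfl⟩ := hz
    refine ⟨m + m', Fin.append u u', Fin.append v v', fun a => ?_, fun a => ?_, ?_⟩
    · induction a using Fin.addCases <;> simp [hu, hu']
    · induction a using Fin.addCases <;> simp [hv, hv']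
    · simp [Fin.sum_univ_add]

theorem Submodule.one_mem_of_eq_one {R A : Type*} [CommSemiring R] [Semiring A] [Algebra R A]
    {M : Submodule R A} (hM : M = 1) : (1 : A) ∈ M :=
  Submodule.one_le.mp hM.ge

section BlockMatrix

variable {R F ι : Type*} [CommRing R] [CommRing F] [Algebra R F] [Fintype ι] [DecidableEq ι]

/-- The subalgebra of matrices whose `(i, j)` entry lies in `J i j`. -/
def Matrix.entrywiseSubalgebra (J : ι → ι → Submodule R F) (hone : ∀ i, J i i = 1)
    (hmul : ∀ i j k, J i j * J j k ≤ J i k) : Subalgebra R (Matrix ι ι F) where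
  carrier := {a | ∀ i j, a i j ∈ J i j}
  mul_mem' ha hb i k := by
    rw [Matrix.mul_apply]
    exact sum_mem fun j _ => hmul i j k (Submodule.mul_mem_mul (ha i j) (hb j k))
  add_mem' ha hb i j := add_mem (ha i j) (hb i j)
  algebraMap_mem' c i j := by
    rw [Matrix.algebraMap_matrix_apply]
    split_ifs with hij
    · subst hij
      rw [hone, Submodule.mem_one]
      exact ⟨c, rfl⟩
    · exact zero_mem _

namespace Matrix.entrywiseSubalgebra

variable {J : ι → ι → Submodule R F} {hone : ∀ i, J i i = 1}
  {hmul : ∀ i j k, J i j * J j k ≤ J i k}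

/-- The matrix with a single entry `c ∈ J i j`. -/
def single (i j : ι) (c : F) (hc : c ∈ J i j) : entrywiseSubalgebra J hone hmul :=
  ⟨Matrix.single i j c, fun k l => by
    rw [Matrix.single_apply]
    split_ifs with h
    · obtain ⟨rfl, rfl⟩ := h
      exact hc
    · exact zero_mem _⟩

@[simp]
theorem coe_single (i j : ι) (c : F) (hc : c ∈ J i j) :
    ((single i j c hc : entrywiseSubalgebra J hone hmul) : Matrix ι ι F) =
      Matrix.single i j c :=
  rfl

theorem sum_single {κ : Type*} (s : Finset κ) (i j : ι) (c : κ → F) (hc : ∀ a, c a ∈ J i j) :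
    ∑ a ∈ s, single i j (c a) (hc a) =
      (single i j (∑ a ∈ s, c a) (sum_mem fun a _ => hc a) : entrywiseSubalgebra J hone hmul) := by
  apply Subtype.ext
  rw [AddSubmonoidClass.coe_finsetSum]
  exact (map_sum (Matrix.singleAddMonoidHom (α := F) i j) c s).symm

theorem smul_single (r : R) (i j : ι) (c : F) (hc : c ∈ J i j) :
    r • single i j c hc =
      (single i j (r • c) (Submodule.smul_mem _ r hc) : entrywiseSubalgebra J hone hmul) :=
  Subtype.ext (Matrix.smul_single r i j c)

theorem single_mul_mul_single (x : entrywiseSubalgebra J hone hmul) (i j k l : ι) (c d : F)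
    (hc : c ∈ J i j) (hd : d ∈ J k l) :
    single i j c hc * x * single k l d hd = single i l (c * x.1 j k * d)
      (hmul _ _ _ (Submodule.mul_mem_mul (hmul _ _ _ (Submodule.mul_mem_mul hc (x.2 j k))) hd)) :=
  Subtype.ext (Matrix.single_mul_mul_single i j k l c x.1 d)

theorem sum_single_one :
    ∑ i, single i i 1 (Submodule.one_mem_of_eq_one (hone i)) =
      (1 : entrywiseSubalgebra J hone hmul) := by
  apply Subtype.ext
  simp [Matrix.sum_single_one]

theorem sum_single_apply (x : entrywiseSubalgebra J hone hmul) :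
    ∑ i, ∑ j, single i j (x.1 i j) (x.2 i j) = x := by
  apply Subtype.ext
  simpa [AddSubmonoidClass.coe_finsetSum] using (Matrix.matrix_eq_sum_single x.1).symm

/-- The functional `x ↦ v * x j k` for `v ∈ J k j`. -/
noncomputable def coord (hinj : Function.Injective (algebraMap R F)) (j k : ι) (v : F)
    (hv : v ∈ J k j) : entrywiseSubalgebra J hone hmul →ₗ[R] R :=
  (LinearEquiv.ofInjective (Algebra.linearMap R F) hinj).symm.toLinearMap ∘ₗ
    LinearMap.codRestrict _ (LinearMap.mulLeft R v ∘ₗ Matrix.entryLinearMap R F j k ∘ₗ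
      (entrywiseSubalgebra J hone hmul).val.toLinearMap) fun x => by
        rw [← Submodule.one_eq_range, ← hone k]
        exact hmul k j k (Submodule.mul_mem_mul hv (x.2 j k))

@[simp]
theorem algebraMap_coord (hinj : Function.Injective (algebraMap R F)) (j k : ι) (v : F)
    (hv : v ∈ J k j) (x : entrywiseSubalgebra J hone hmul) :
    algebraMap R F (coord hinj j k v hv x) = v * x.1 j k := by
  have := LinearEquiv.apply_symm_apply (LinearEquiv.ofInjective (Algebra.linearMap R F) hinj)
  exact congrArg Subtype.val (this _)

/-- If moreover `J i j * J j i = 1` for all `i`, `j`, the subalgebra is Azumaya. -/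
theorem isAzumaya [Nonempty ι] (hinj : Function.Injective (algebraMap R F))
    (hinv : ∀ i j, 1 ≤ J i j * J j i) : IsAzumaya R (entrywiseSubalgebra J hone hmul) := by
  have hsum (i j : ι) : ∃ (m : ℕ) (u v : Fin m → F), (∀ a, u a ∈ J i j) ∧
      (∀ a, v a ∈ J j i) ∧ ∑ a, u a * v a = 1 :=
    Submodule.exists_fin_sum_mul_of_mem_mul (Submodule.one_le.mp (hinv i j))
  choose m u v hu hv huv using hsum
  let S := Σ p : ι × ι, Fin (m p.1 p.2)
  let w (s : S) : entrywiseSubalgebra J hone hmul := single s.1.1 s.1.2 (u _ _ s.2) (hu _ _ s.2)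
  let φ (s : S) : entrywiseSubalgebra J hone hmul →ₗ[R] R :=
    coord hinj s.1.1 s.1.2 (v _ _ s.2) (hv _ _ s.2)
  have hvv (s : S) (l : ι) (b : Fin (m l s.1.1)) :
      v _ _ s.2 * v _ _ b ∈ J s.1.2 l :=
    hmul _ _ _ (Submodule.mul_mem_mul (hv _ _ s.2) (hv _ _ b))
  have hscal (b : entrywiseSubalgebra J hone hmul) (j k l : ι) (a : Fin (m j k))
      (c : Fin (m l j)) :
      u _ _ a * v _ _ a * (u _ _ c * v _ _ c) * b.1 k l ∈ J k l := by
    have h₁ : v _ _ a * u _ _ a ∈ J k k := hmul _ _ _ (Submodule.mul_mem_mul (hv _ _ a) (hu _ _ a))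
    have h₂ : u _ _ c * v _ _ c ∈ J l l := hmul _ _ _ (Submodule.mul_mem_mul (hu _ _ c) (hv _ _ c))
    have := hmul _ _ _ (Submodule.mul_mem_mul (hmul _ _ _ (Submodule.mul_mem_mul h₁ (b.2 k l))) h₂)
    convert this using 1
    ring
  let t (s : S) : entrywiseSubalgebra J hone hmul ⊗[R] (entrywiseSubalgebra J hone hmul)ᵐᵒᵖ :=
    ∑ l, ∑ b, single l s.1.1 (u _ _ b) (hu _ _ b) ⊗ₜ[R]
      MulOpposite.op (single s.1.2 l (v _ _ s.2 * v _ _ b) (hvv s l b))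
  have hφ (x : entrywiseSubalgebra J hone hmul) : ∑ s, φ s x • w s = x := by
    conv_rhs => rw [← sum_single_apply x]
    simp only [S, Fintype.sum_sigma, Fintype.sum_prod_type]
    refine Finset.sum_congr rfl fun j _ => Finset.sum_congr rfl fun k _ => ?_
    simp only [w, φ, smul_single, sum_single]
    congr 1
    simp only [Algebra.smul_def, algebraMap_coord]
    calc _ = (∑ a, u j k a * v j k a) * x.1 j k := by
          rw [Finset.sum_mul]
          exact Finset.sum_congr rfl fun a _ => by ring
      _ = _ := by rw [huv, one_mul]
  have ht (s : S) (x : entrywiseSubalgebra J hone hmul) :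
      AlgHom.mulLeftRight R (entrywiseSubalgebra J hone hmul) (t s) x =
        algebraMap R (entrywiseSubalgebra J hone hmul) (φ s x) := by
    rw [Algebra.algebraMap_eq_smul_one, ← sum_single_one, Finset.smul_sum]
    simp only [t, map_sum, LinearMap.sum_apply, AlgHom.mulLeftRight_apply,
      MulOpposite.unop_op, single_mul_mul_single, sum_single, smul_single]
    refine Finset.sum_congr rfl fun l _ => ?_
    congr 1
    simp only [Algebra.smul_def, φ, algebraMap_coord]
    calc _ = (∑ b, u l s.1.1 b * v l s.1.1 b) * (v _ _ s.2 * x.1 s.1.1 s.1.2) := by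
          rw [Finset.sum_mul]
          exact Finset.sum_congr rfl fun a _ => by ring
      _ = _ := by rw [huv]; ring
  have htw (b : entrywiseSubalgebra J hone hmul) :
      ∑ s, ((w s * b) ⊗ₜ[R] (1 : (entrywiseSubalgebra J hone hmul)ᵐᵒᵖ)) * t s =
        1 ⊗ₜ[R] MulOpposite.op b := by
    have hterm (j k l : ι) (a : Fin (m j k)) (c : Fin (m l j)) :
        (single j k (u _ _ a) (hu _ _ a) * b * single l j (u _ _ c) (hu _ _ c)) ⊗ₜ[R]
          MulOpposite.op (single k l (v _ _ a * v _ _ c) (hvv ⟨(j, k), a⟩ l c)) =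
        single j j 1 (Submodule.one_mem_of_eq_one (hone j)) ⊗ₜ[R] MulOpposite.op
          (single k l (u _ _ a * v _ _ a * (u _ _ c * v _ _ c) * b.1 k l)
            (hscal b j k l a c) : entrywiseSubalgebra J hone hmul) := by
      have hmem : u j k a * b.1 k l * u l j c ∈ J j j :=
        hmul _ _ _ (Submodule.mul_mem_mul
          (hmul _ _ _ (Submodule.mul_mem_mul (hu _ _ a) (b.2 k l))) (hu _ _ c))
      obtain ⟨d, hd⟩ := Submodule.mem_one.mp (hone j ▸ hmem)
      have h₁ : single j k (u _ _ a) (hu _ _ a) * b * single l j (u _ _ c) (hu _ _ c) =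
          d • single j j 1 (Submodule.one_mem_of_eq_one (hone j)) := by
        rw [single_mul_mul_single, smul_single]
        congr 1
        rw [← hd, Algebra.smul_def, mul_one]
      rw [h₁, TensorProduct.smul_tmul, ← MulOpposite.op_smul, smul_single]
      congr 3
      rw [Algebra.smul_def, hd]
      ring
    conv_rhs => rw [← sum_single_one, ← sum_single_apply b]
    simp only [S, Fintype.sum_sigma, Fintype.sum_prod_type, w, t, Finset.mul_sum,
      Algebra.TensorProduct.tmul_mul_tmul, one_mul, hterm, TensorProduct.sum_tmul]
    refine Finset.sum_congr rfl fun j _ => ?_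
    simp only [Finset.op_sum, TensorProduct.tmul_sum]
    refine Finset.sum_congr rfl fun k _ => ?_
    rw [Finset.sum_comm]
    refine Finset.sum_congr rfl fun l _ => ?_
    simp only [← TensorProduct.tmul_sum, ← Finset.op_sum, sum_single, ← Finset.sum_mul,
      ← Finset.mul_sum, huv, mul_one]
    refine (TensorProduct.tmul_sum (R := R)
      (single j j 1 (Submodule.one_mem_of_eq_one (hone j))) _ _).symm.trans ?_
    simp only [← Finset.op_sum, sum_single, ← Finset.sum_mul, huv, one_mul]
  exact
    { toProjective := .of_dualBasis hφ
      toFinite := .of_dualBasis hφ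
      toFaithfulSMul := (faithfulSMul_iff_algebraMap_injective R _).mpr fun c d h => by
        let i := Classical.arbitrary ι
        have := congrArg (fun x => x.1 i i) h
        exact hinj (by simpa [Matrix.algebraMap_matrix_apply] using this)
      bij := AlgHom.mulLeftRight_bijective_of_dualBasis hφ ht htw }

end Matrix.entrywiseSubalgebra

end BlockMatrix

set_option synthInstance.maxHeartbeats 1000000 in
/-- Let `R` be a domain with fraction field `F`, and `I` an invertible ideal of `R` with
inverse fractional ideal `I⁻¹` (so `I * I⁻¹ = R`).  For `1 ≤ n` and `r ≤ n`, the set of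
`n × n` matrices over `F` whose entries lie in `R` on the two diagonal blocks (rows and
columns both `< r`, or both `≥ r`), in `I` on the upper right block and in `I⁻¹` on the
lower left block, is an `R`-subalgebra of `M_n(F)` which is an Azumaya algebra over `R`:
it is a finitely generated, faithful, projective `R`-module, and the natural map
`A' ⊗[R] A'ᵐᵒᵖ → End_R A'` is bijective. -/
theorem elementaryTransform_local_model_isAzumaya
    (R F : Type*) [CommRing R] [IsDomain R] [Field F] [Algebra R F] [IsFractionRing R F]
    (I : Ideal R)
    (hI : (I : FractionalIdeal (nonZeroDivisors R) F) *
      (I : FractionalIdeal (nonZeroDivisors R) F)⁻¹ = 1)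
    (n r : ℕ) (hn : 1 ≤ n) (hr : r ≤ n) :
    ∃ A' : Subalgebra R (Matrix (Fin n) (Fin n) F),
      (A' : Set (Matrix (Fin n) (Fin n) F)) =
        {a : Matrix (Fin n) (Fin n) F | ∀ i j : Fin n,
          ((i : ℕ) < r ∧ (j : ℕ) < r →
            a i j ∈ (1 : FractionalIdeal (nonZeroDivisors R) F)) ∧
          (r ≤ (i : ℕ) ∧ r ≤ (j : ℕ) →
            a i j ∈ (1 : FractionalIdeal (nonZeroDivisors R) F)) ∧
          ((i : ℕ) < r ∧ r ≤ (j : ℕ) →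
            a i j ∈ (I : FractionalIdeal (nonZeroDivisors R) F)) ∧
          ((j : ℕ) < r ∧ r ≤ (i : ℕ) →
            a i j ∈ (I : FractionalIdeal (nonZeroDivisors R) F)⁻¹)} ∧
      Module.Finite R A' ∧ FaithfulSMul R A' ∧ Module.Projective R A' ∧
      Function.Bijective (mulLeftRightMap R A') := by
  let L (i : Fin n) : FractionalIdeal (nonZeroDivisors R) F := if (i : ℕ) < r then I else 1
  have hL (i : Fin n) : L i * (L i)⁻¹ = 1 := by
    by_cases h : (i : ℕ) < r <;> simp [L, h, hI]
  let J (i j : Fin n) : FractionalIdeal (nonZeroDivisors R) F := L i * (L j)⁻¹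
  have hone (i : Fin n) : (J i i : Submodule R F) = 1 := by simp [J, hL]
  have hJ (i j k : Fin n) : J i j * J j k = J i k := by
    simp only [J]
    rw [mul_assoc, ← mul_assoc _ (L j), mul_comm _ (L j), hL, one_mul]
  have hmul (i j k : Fin n) : (J i j * J j k : Submodule R F) ≤ J i k := by
    rw [← FractionalIdeal.coe_mul, hJ]
  have hinv (i j : Fin n) : (1 : Submodule R F) ≤ J i j * J j i := by
    rw [← FractionalIdeal.coe_mul, hJ, hone]
  have : Nonempty (Fin n) := ⟨⟨0, hn⟩⟩
  have hA := Matrix.entrywiseSubalgebra.isAzumaya (hone := hone) (hmul := hmul)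
    (IsFractionRing.injective R F) hinv
  refine ⟨Matrix.entrywiseSubalgebra (fun i j => (J i j : Submodule R F)) hone hmul, ?_,
    hA.toFinite, hA.toFaithfulSMul, hA.toProjective, ?_⟩
  · ext a
    refine forall₂_congr fun i j => ?_
    rw [FractionalIdeal.mem_coe]
    by_cases hi : (i : ℕ) < r <;> by_cases hj : (j : ℕ) < r <;>
      simp [J, L, hi, hj, hI, not_le.mpr, not_lt.mp]
  · rw [mulLeftRightMap_eq_mulLeftRight]
    exact hA.bij
end
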